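/- If for every n the bound f_ω₁(n) exists (i.e., is a well-defined natural number) and the function n ↦ f_ω₁(n) is majorized by a computable function, then every recursively enumerable subset of ℕ is computable — contradiction; hence f_ω₁ dominates all computable functions in the sense that f_ω₁ is not majorized by any computable function. -/

import Mathlib

/-- An equation of one of the forms x_k = 1, x_i + x_j = x_k, x_i · x_j = x_k,
coded by the indices of its variables. -/
abbrev DEqn : Type := ℕ ⊕ (ℕ × ℕ × ℕ) ⊕ (ℕ × ℕ × ℕ)

/-- The equation coded by `e` holds under the valuation `v`. -/
def DEqn.holds (v : ℕ → ℕ) : DEqn → Prop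
  | Sum.inl k => v k = 1
  | Sum.inr (Sum.inl (i, j, k)) => v i + v j = v k
  | Sum.inr (Sum.inr (i, j, k)) => v i * v j = v k

/-- The equation `e` belongs to E_n, i.e., all its variable indices are among x_1,...,x_n
(0-indexed: < n). -/
def DEqn.inE (n : ℕ) : DEqn → Prop
  | Sum.inl k => k < n
  | Sum.inr (Sum.inl (i, j, k)) => i < n ∧ j < n ∧ k < n
  | Sum.inr (Sum.inr (i, j, k)) => i < n ∧ j < n ∧ k < n

/-- Extend a tuple x ∈ ℕⁿ to a valuation ℕ → ℕ (zero outside). -/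
def extVal (n : ℕ) (x : Fin n → ℕ) : ℕ → ℕ := fun i => if h : i < n then x ⟨i, h⟩ else 0

/-- The set of solutions in ℕⁿ of the system S. -/
def SolSet (n : ℕ) (S : Set DEqn) : Set (Fin n → ℕ) :=
  {x | ∀ e ∈ S, DEqn.holds (extVal n x) e}

/-- `b` is an admissible bound for n and κ: every system S ⊆ E_n which is solvable in ℕⁿ
and has fewer than κ solutions in ℕⁿ has a solution with all coordinates ≤ b.
(f_κ(n) is the least such b.) -/
def IsBound (κ : Cardinal) (n b : ℕ) : Prop :=
  ∀ S : Set DEqn, (∀ e ∈ S, DEqn.inE n e) → (SolSet n S).Nonempty →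
    Cardinal.mk (SolSet n S) < κ → ∃ x ∈ SolSet n S, ∀ i, x i ≤ b

namespace DPRM

inductive Eqn (σ : Type) : Type
  | one (k : σ) : Eqn σ
  | add (i j k : σ) : Eqn σ
  | mul (i j k : σ) : Eqn σ

namespace Eqn
variable {σ τ : Type}

def sat (w : σ → ℕ) : Eqn σ → Prop
  | one k => w k = 1
  | add i j k => w i + w j = w k
  | mul i j k => w i * w j = w k

def vars : Eqn σ → List σ
  | one k => [k]
  | add i j k => [i, j, k]
  | mul i j k => [i, j, k]

def ren (f : σ → τ) : Eqn σ → Eqn τ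
  | one k => one (f k)
  | add i j k => add (f i) (f j) (f k)
  | mul i j k => mul (f i) (f j) (f k)

theorem sat_ren (f : σ → τ) (w : τ → ℕ) (e : Eqn σ) : (e.ren f).sat w ↔ e.sat (w ∘ f) := by
  cases e <;> rfl

theorem sat_congr {w w' : σ → ℕ} {e : Eqn σ} (h : ∀ i ∈ e.vars, w i = w' i) :
    e.sat w ↔ e.sat w' := by
  cases e <;> simp_all [vars, sat]

end Eqn

def Skolem {σ : Type} (p : Poly σ) : Prop :=
  ∃ (τ : Type) (L : List (Eqn (σ ⊕ τ))) (a b : σ ⊕ τ),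
    (∀ v, ∃ t, ∀ e ∈ L, e.sat (Sum.elim v t)) ∧
    ∀ v t, (∀ e ∈ L, e.sat (Sum.elim v t)) →
      p v = ((Sum.elim v t a : ℕ) : ℤ) - ((Sum.elim v t b : ℕ) : ℤ)

section
variable {σ : Type}

theorem skolem_proj (i : σ) : Skolem (Poly.proj i) := by
  refine ⟨Unit, [.add (.inr ()) (.inr ()) (.inr ())], .inl i, .inr (), fun v => ⟨fun _ => 0, ?_⟩,
    fun v t h => ?_⟩
  · simp [Eqn.sat]
  · simp [Eqn.sat] at h
    simp [h]

theorem skolem_zero : Skolem (Poly.const 0 : Poly σ) := by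
  refine ⟨Unit, [.add (.inr ()) (.inr ()) (.inr ())], .inr (), .inr (), fun v => ⟨fun _ => 0, ?_⟩,
    fun v t h => ?_⟩
  · simp [Eqn.sat]
  · simp 

theorem skolem_one : Skolem (Poly.const 1 : Poly σ) := by
  refine ⟨Bool, [.add (.inr true) (.inr true) (.inr true), .one (.inr false)],
    .inr false, .inr true, fun v => ⟨fun b => if b then 0 else 1, ?_⟩, fun v t h => ?_⟩
  · simp [Eqn.sat]
  · simp [Eqn.sat] at h
    simp [h]

def j1 {σ τ₁ τ₂ κ : Type} : σ ⊕ τ₁ → σ ⊕ (τ₁ ⊕ τ₂ ⊕ κ) := Sum.map id Sum.inl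
def j2 {σ τ₁ τ₂ κ : Type} : σ ⊕ τ₂ → σ ⊕ (τ₁ ⊕ τ₂ ⊕ κ) := Sum.map id (Sum.inr ∘ Sum.inl)

theorem elim_j1 {σ τ₁ τ₂ κ : Type} (v : σ → ℕ) (t : τ₁ ⊕ τ₂ ⊕ κ → ℕ) :
    (Sum.elim v t) ∘ j1 = Sum.elim v (t ∘ Sum.inl) := by
  funext s; cases s <;> rfl
theorem elim_j2 {σ τ₁ τ₂ κ : Type} (v : σ → ℕ) (t : τ₁ ⊕ τ₂ ⊕ κ → ℕ) :
    (Sum.elim v t) ∘ j2 = Sum.elim v (t ∘ Sum.inr ∘ Sum.inl) := by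
  funext s; cases s <;> rfl
theorem elim_j1' {σ τ₁ τ₂ κ : Type} (v : σ → ℕ) (t : τ₁ ⊕ τ₂ ⊕ κ → ℕ) (a) :
    (Sum.elim v t) (j1 a) = Sum.elim v (t ∘ Sum.inl) a := congrFun (elim_j1 v t) a
theorem elim_j2' {σ τ₁ τ₂ κ : Type} (v : σ → ℕ) (t : τ₁ ⊕ τ₂ ⊕ κ → ℕ) (a) :
    (Sum.elim v t) (j2 a) = Sum.elim v (t ∘ Sum.inr ∘ Sum.inl) a := congrFun (elim_j2 v t) a

theorem skolem_sub {p q : Poly σ} (hp : Skolem p) (hq : Skolem q) : Skolem (p - q) := by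
  obtain ⟨τ₁, L₁, a, b, h1, h1'⟩ := hp
  obtain ⟨τ₂, L₂, c, d, h2, h2'⟩ := hq
  let n : Fin 2 → σ ⊕ (τ₁ ⊕ τ₂ ⊕ Fin 2) := fun i => .inr (.inr (.inr i))
  refine ⟨τ₁ ⊕ τ₂ ⊕ Fin 2, L₁.map (Eqn.ren j1) ++ L₂.map (Eqn.ren j2) ++
    [.add (j1 a) (j2 d) (n 0), .add (j1 b) (j2 c) (n 1)], n 0, n 1, fun v => ?_, fun v t h => ?_⟩
  · obtain ⟨t1, ht1⟩ := h1 v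
    obtain ⟨t2, ht2⟩ := h2 v
    refine ⟨Sum.elim t1 (Sum.elim t2 ![Sum.elim v t1 a + Sum.elim v t2 d,
      Sum.elim v t1 b + Sum.elim v t2 c]), ?_⟩
    simp only [List.mem_append, List.mem_map]
    rintro e ((⟨e, he, rfl⟩ | ⟨e, he, rfl⟩) | he)
    · rw [Eqn.sat_ren, elim_j1]; exact ht1 e he
    · rw [Eqn.sat_ren, elim_j2]; exact ht2 e he
    · simp at he
      rcases he with rfl | rfl <;> simp only [Eqn.sat, elim_j1', elim_j2'] <;> rfl
  · have e1 := h1' v (t ∘ Sum.inl) fun e he => by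
      rw [← elim_j1, ← Eqn.sat_ren]; exact h _ (by simp; exact .inl ⟨e, he, rfl⟩)
    have e2 := h2' v (t ∘ Sum.inr ∘ Sum.inl) fun e he => by
      rw [← elim_j2, ← Eqn.sat_ren]; exact h _ (by simp; exact .inr (.inl ⟨e, he, rfl⟩))
    have e3 := h (.add (j1 a) (j2 d) (n 0)) (by simp)
    have e4 := h (.add (j1 b) (j2 c) (n 1)) (by simp)
    simp only [Eqn.sat, elim_j1', elim_j2'] at e3 e4
    rw [Poly.sub_apply, e1, e2, ← e3, ← e4]
    push_cast; ring

theorem skolem_mul {p q : Poly σ} (hp : Skolem p) (hq : Skolem q) : Skolem (p * q) := by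
  obtain ⟨τ₁, L₁, a, b, h1, h1'⟩ := hp
  obtain ⟨τ₂, L₂, c, d, h2, h2'⟩ := hq
  let n : Fin 6 → σ ⊕ (τ₁ ⊕ τ₂ ⊕ Fin 6) := fun i => .inr (.inr (.inr i))
  refine ⟨τ₁ ⊕ τ₂ ⊕ Fin 6, L₁.map (Eqn.ren j1) ++ L₂.map (Eqn.ren j2) ++
    [.mul (j1 a) (j2 c) (n 0), .mul (j1 b) (j2 d) (n 1), .mul (j1 a) (j2 d) (n 2),
     .mul (j1 b) (j2 c) (n 3), .add (n 0) (n 1) (n 4), .add (n 2) (n 3) (n 5)],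
    n 4, n 5, fun v => ?_, fun v t h => ?_⟩
  · obtain ⟨t1, ht1⟩ := h1 v
    obtain ⟨t2, ht2⟩ := h2 v
    refine ⟨Sum.elim t1 (Sum.elim t2 ![Sum.elim v t1 a * Sum.elim v t2 c,
      Sum.elim v t1 b * Sum.elim v t2 d, Sum.elim v t1 a * Sum.elim v t2 d,
      Sum.elim v t1 b * Sum.elim v t2 c,
      Sum.elim v t1 a * Sum.elim v t2 c + Sum.elim v t1 b * Sum.elim v t2 d,
      Sum.elim v t1 a * Sum.elim v t2 d + Sum.elim v t1 b * Sum.elim v t2 c]), ?_⟩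
    simp only [List.mem_append, List.mem_map]
    rintro e ((⟨e, he, rfl⟩ | ⟨e, he, rfl⟩) | he)
    · rw [Eqn.sat_ren, elim_j1]; exact ht1 e he
    · rw [Eqn.sat_ren, elim_j2]; exact ht2 e he
    · simp at he
      rcases he with rfl | rfl | rfl | rfl | rfl | rfl <;>
        simp only [Eqn.sat, elim_j1', elim_j2'] <;> rfl
  · have e1 := h1' v (t ∘ Sum.inl) fun e he => by
      rw [← elim_j1, ← Eqn.sat_ren]; exact h _ (by simp; exact .inl ⟨e, he, rfl⟩)
    have e2 := h2' v (t ∘ Sum.inr ∘ Sum.inl) fun e he => by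
      rw [← elim_j2, ← Eqn.sat_ren]; exact h _ (by simp; exact .inr (.inl ⟨e, he, rfl⟩))
    have e3 := h (.mul (j1 a) (j2 c) (n 0)) (by simp)
    have e4 := h (.mul (j1 b) (j2 d) (n 1)) (by simp)
    have e5 := h (.mul (j1 a) (j2 d) (n 2)) (by simp)
    have e6 := h (.mul (j1 b) (j2 c) (n 3)) (by simp)
    have e7 := h (.add (n 0) (n 1) (n 4)) (by simp)
    have e8 := h (.add (n 2) (n 3) (n 5)) (by simp)
    simp only [Eqn.sat, elim_j1', elim_j2'] at e3 e4 e5 e6 e7 e8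
    rw [Poly.mul_apply, e1, e2, ← e7, ← e8, ← e3, ← e4, ← e5, ← e6]
    push_cast; ring

theorem skolem_const (n : ℤ) : Skolem (Poly.const n : Poly σ) := by
  have hn : ∀ n : ℕ, Skolem (Poly.const (n : ℤ) : Poly σ) := by
    intro n
    induction n with
    | zero => exact skolem_zero
    | succ n ih =>
      have := skolem_sub ih (skolem_sub skolem_zero skolem_one)
      convert this using 1
      ext x
      simp
  obtain ⟨m, rfl | rfl⟩ := n.eq_nat_or_neg
  · exact hn m
  · convert skolem_sub skolem_zero (hn m) using 1
    ext x
    simp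

theorem skolem (p : Poly σ) : Skolem p :=
  Poly.induction skolem_proj skolem_const (fun _ _ => skolem_sub) (fun _ _ => skolem_mul) p

theorem sysForm {S : Set (σ → ℕ)} (h : Dioph S) :
    ∃ (τ : Type) (L : List (Eqn (σ ⊕ τ))), ∀ v, v ∈ S ↔ ∃ t, ∀ e ∈ L, e.sat (Sum.elim v t) := by
  obtain ⟨β, p, hp⟩ := h
  obtain ⟨τ, L, a, b, h1, h2⟩ := skolem p
  let f : (σ ⊕ β) ⊕ τ → σ ⊕ (β ⊕ τ ⊕ Unit) :=
    Sum.elim (Sum.elim .inl (.inr ∘ .inl)) (.inr ∘ .inr ∘ .inl)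
  have hf : ∀ (v : σ → ℕ) (t : β ⊕ τ ⊕ Unit → ℕ), Sum.elim v t ∘ f =
      Sum.elim (Sum.elim v (t ∘ .inl)) (t ∘ .inr ∘ .inl) := by
    intro v t; funext s; rcases s with (s | s) | s <;> rfl
  refine ⟨β ⊕ τ ⊕ Unit, L.map (Eqn.ren f) ++ [.add (.inr (.inr (.inr ()))) (.inr (.inr (.inr ())))
    (.inr (.inr (.inr ()))), .add (f a) (.inr (.inr (.inr ()))) (f b)], fun v => ?_⟩
  rw [hp]
  constructor
  · rintro ⟨t, ht⟩
    obtain ⟨s, hs⟩ := h1 (Sum.elim v t)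
    have := h2 _ _ hs
    refine ⟨Sum.elim t (Sum.elim s fun _ => 0), ?_⟩
    simp only [List.mem_append, List.mem_map]
    rintro e (⟨e, he, rfl⟩ | he)
    · rw [Eqn.sat_ren, hf]; exact hs e he
    · simp at he
      rcases he with rfl | rfl
      · simp [Eqn.sat]
      · have e1 := congrFun (hf v (Sum.elim t (Sum.elim s fun _ => 0))) a
        have e2 := congrFun (hf v (Sum.elim t (Sum.elim s fun _ => 0))) b
        simp only [Function.comp] at e1 e2
        simp only [Eqn.sat, e1, e2]
        change Sum.elim (Sum.elim v t) s a + 0 = Sum.elim (Sum.elim v t) s b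
        omega
  · rintro ⟨t, ht⟩
    have hL := h2 (Sum.elim v (t ∘ .inl)) (t ∘ .inr ∘ .inl) fun e he => by
      rw [← hf, ← Eqn.sat_ren]; exact ht _ (by simp; exact .inl ⟨e, he, rfl⟩)
    refine ⟨t ∘ .inl, ?_⟩
    rw [hL, ← hf]
    have e1 := ht (.add (.inr (.inr (.inr ()))) (.inr (.inr (.inr ())))
      (.inr (.inr (.inr ())))) (by simp)
    have e2 := ht (.add (f a) (.inr (.inr (.inr ()))) (f b)) (by simp)
    simp [Eqn.sat] at e1 e2
    simp only [Function.comp, e1] at *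
    omega
end
end DPRM

namespace DPRM
open Nat

theorem digit_lem (u : ℕ) : ∀ (k N : ℕ) (c : ℕ → ℕ), (∀ i, c i < u) →
    (∑ i ∈ Finset.range N, c i * u ^ i) / u ^ k % u = if k < N then c k else 0 := by
  intro k
  induction k with
  | zero =>
    intro N c hc
    cases N with
    | zero => simp
    | succ N =>
      rw [Finset.sum_range_succ']
      simp only [pow_succ, ← mul_assoc, ← Finset.sum_mul]
      simp [Nat.mod_eq_of_lt (hc 0)]
  | succ k ih =>
    intro N c hc
    have hu : 0 < u := lt_of_le_of_lt (Nat.zero_le _) (hc 0)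
    cases N with
    | zero => simp
    | succ N =>
      rw [Finset.sum_range_succ']
      simp only [pow_succ, ← mul_assoc, ← Finset.sum_mul]
      rw [mul_comm (u ^ k) u, ← Nat.div_div_eq_div_mul]
      have : ((∑ i ∈ Finset.range N, c (i + 1) * u ^ i) * u + c 0 * u ^ 0) / u
          = ∑ i ∈ Finset.range N, c (i + 1) * u ^ i := by
        rw [pow_zero, mul_one, mul_comm, Nat.mul_add_div hu, Nat.div_eq_of_lt (hc 0), add_zero]
      rw [this, ih N (fun i => c (i + 1)) (fun i => hc _)]
      simp

theorem choose_formula (n k : ℕ) :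
    n.choose k = (2 ^ n + 1 + 1) ^ n / (2 ^ n + 1) ^ k % (2 ^ n + 1) := by
  rw [add_pow]
  simp only [one_pow, mul_one]
  have := digit_lem (2 ^ n + 1) k (n + 1) (fun i => n.choose i)
    (fun i => Nat.lt_succ_of_le (Nat.choose_le_two_pow n i))
  simp only [Nat.cast_id, mul_comm] at this ⊢
  rw [this]
  split_ifs with h
  · rfl
  · exact Nat.choose_eq_zero_of_lt (by omega)

theorem bern (s n : ℕ) : ∀ m : ℕ, (s + n) ^ (m + 1) ≤ (s + n) * s ^ m + m * n * (s + n) ^ m := by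
  intro m
  induction m with
  | zero => simp
  | succ m ih =>
    have h1 : n * (s + n) * s ^ m ≤ n * (s + n) * (s + n) ^ m :=
      Nat.mul_le_mul_left _ (Nat.pow_le_pow_left (by omega) _)
    calc (s + n) ^ (m + 1 + 1) = (s + n) * (s + n) ^ (m + 1) := by ring
      _ ≤ (s + n) * ((s + n) * s ^ m + m * n * (s + n) ^ m) := Nat.mul_le_mul_left _ ih
      _ = (s + n) * s ^ (m + 1) + n * (s + n) * s ^ m + m * n * (s + n) ^ (m + 1) := by ring
      _ ≤ (s + n) * s ^ (m + 1) + n * (s + n) * (s + n) ^ m + m * n * (s + n) ^ (m + 1) := by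
        gcongr
      _ = _ := by ring

theorem factorial_formula (n : ℕ) :
    n ! = (n * n * (n ^ n + 1) + n + 1) ^ n / (n * n * (n ^ n + 1) + n + 1).choose n := by
  set r := n * n * (n ^ n + 1) + n + 1 with hr
  have hpos : 0 < r.choose n := Nat.choose_pos (by omega)
  have hd : r.descFactorial n = n ! * r.choose n := Nat.descFactorial_eq_factorial_mul_choose r n
  symm
  rw [Nat.div_eq_iff hpos]
  have h1 : r.descFactorial n ≤ r ^ n := Nat.descFactorial_le_pow r n
  have h2 : r ^ n < (n ! + 1) * r.choose n := by
    have h3 : (r + 1 - n) ^ n ≤ r.descFactorial n := Nat.pow_sub_le_descFactorial r n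
    have h4 : (r - n) ^ n ≤ r.descFactorial n := le_trans (Nat.pow_le_pow_left (by omega) _) h3
    have h5 := bern (r - n) n n
    rw [Nat.sub_add_cancel (by omega)] at h5
    have hf : n ! ≤ n ^ n := Nat.factorial_le_pow n
    have h6 : n * n * (n ! + 1) < r := by
      have : n * n * (n ! + 1) ≤ n * n * (n ^ n + 1) := by gcongr
      omega
    have h7 : r ^ (n + 1) ≤ r * r.descFactorial n + n * n * r ^ n :=
      h5.trans (by gcongr)
    have hrn : 0 < r ^ n := Nat.pow_pos (by omega)
    have h8 : n ! * r * r ^ n < (n ! + 1) * (r * r.descFactorial n) := by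
      have : (n ! + 1) * r ^ (n + 1) ≤ (n ! + 1) * (r * r.descFactorial n) +
          (n * n * (n ! + 1)) * r ^ n := by nlinarith
      have h9 : (n * n * (n ! + 1)) * r ^ n < r * r ^ n := Nat.mul_lt_mul_of_pos_right h6 hrn
      have : (n ! + 1) * r ^ (n + 1) = n ! * r * r ^ n + r * r ^ n := by ring
      omega
    rw [hd] at h8
    have h10 : (n ! * r) * r ^ n < (n ! * r) * ((n ! + 1) * r.choose n) := by
      calc _ < _ := h8
        _ = _ := by ring
    exact Nat.lt_of_mul_lt_mul_left h10
  rw [hd] at h1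
  constructor
  · exact h1
  · rw [add_mul] at h2; omega

open Dioph
open scoped Dioph
variable {α : Type}

theorem choose_dioph {f g : (α → ℕ) → ℕ} (df : DiophFn f) (dg : DiophFn g) :
    DiophFn fun v => (f v).choose (g v) := by
  simp only [choose_formula]
  have d2 : DiophFn fun v => 2 ^ f v + 1 := add_dioph (pow_dioph (const_dioph 2) df) (const_dioph 1)
  exact mod_dioph (div_dioph (pow_dioph (add_dioph d2 (const_dioph 1)) df) (pow_dioph d2 dg)) d2

theorem factorial_dioph {f : (α → ℕ) → ℕ} (df : DiophFn f) : DiophFn fun v => (f v)! := by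
  simp only [factorial_formula]
  have d : DiophFn fun v => f v * f v * (f v ^ f v + 1) + f v + 1 :=
    add_dioph (add_dioph (mul_dioph (mul_dioph df df)
      (add_dioph (pow_dioph df df) (const_dioph 1))) df) (const_dioph 1)
  exact div_dioph (pow_dioph d df) (choose_dioph d df)

end DPRM

namespace DPRM
open Nat

def mm (w k : ℕ) : ℕ := (w ! / (k + 1)) * (w !) - 1

theorem mm_succ {w k : ℕ} (hk : k < w) : mm w k + 1 = (w ! / (k + 1)) * w ! := by
  have h1 : k + 1 ∣ w ! := Nat.dvd_factorial (by omega) (by omega)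
  have : 0 < (w ! / (k + 1)) * w ! :=
    Nat.mul_pos (Nat.div_pos (Nat.le_of_dvd (Nat.factorial_pos _) h1) (by omega))
      (Nat.factorial_pos _)
  unfold mm; omega

theorem mm_mul {w k : ℕ} (hk : k < w) : (k + 1) * (mm w k + 1) = w ! * w ! := by
  have h1 : k + 1 ∣ w ! := Nat.dvd_factorial (by omega) (by omega)
  rw [mm_succ hk, ← mul_assoc, Nat.mul_div_cancel' h1]

theorem mm_dvd {w k : ℕ} (hk : k < w) : w ! ∣ mm w k + 1 := by
  rw [mm_succ hk]; exact dvd_mul_left _ _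

theorem mm_coprime_fact {w k : ℕ} (hk : k < w) : Nat.Coprime (mm w k) (w !) :=
  Nat.Coprime.coprime_dvd_right (mm_dvd hk) (by simp)

theorem mm_coprime {w k j : ℕ} (hk : k < w) (hj : 0 < j) (hjw : j ≤ w) :
    Nat.Coprime (mm w k) j :=
  Nat.Coprime.coprime_dvd_right (Nat.dvd_factorial hj hjw) (mm_coprime_fact hk)

theorem mm_pair_aux {w i k : ℕ} (hk : k < w) (hik : i < k) : Nat.Coprime (mm w i) (mm w k) := by
  have hi : i < w := by omega
  have e1 := mm_mul hi
  have e2 := mm_mul hk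
  have hg : Nat.gcd (mm w i) (mm w k) ∣ k - i := by
    have h1 : Nat.gcd (mm w i) (mm w k) ∣ (i + 1) * mm w i := (Nat.gcd_dvd_left _ _).mul_left _
    have h2 : Nat.gcd (mm w i) (mm w k) ∣ (k + 1) * mm w k := (Nat.gcd_dvd_right _ _).mul_left _
    have h3 : k - i = (i + 1) * mm w i - (k + 1) * mm w k := by
      rw [mul_add] at e1 e2; omega
    rw [h3]; exact Nat.dvd_sub h1 h2
  have hc := mm_coprime (j := k - i) hi (by omega) (by omega)
  exact Nat.eq_one_of_dvd_coprimes hc (Nat.gcd_dvd_left _ _) hg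

theorem mm_pair {w i k : ℕ} (hi : i < w) (hk : k < w) (hik : i ≠ k) :
    Nat.Coprime (mm w i) (mm w k) := by
  rcases lt_or_gt_of_ne hik with h | h
  · exact mm_pair_aux hk h
  · exact (mm_pair_aux hi h).symm

theorem mm_prod {w y : ℕ} (hy : y ≤ w) :
    ∏ k ∈ Finset.range y, mm w k = (w ! * (w !) - 1).choose y := by
  have h1 : y ! * (w ! * (w !) - 1).choose y = y ! * ∏ k ∈ Finset.range y, mm w k := by
    rw [← Nat.descFactorial_eq_factorial_mul_choose, Nat.descFactorial_eq_prod_range,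
      ← Finset.prod_range_add_one_eq_factorial y, ← Finset.prod_mul_distrib]
    refine Finset.prod_congr rfl fun k hk => ?_
    have := mm_mul (w := w) (k := k) (by simp at hk; omega)
    rw [mul_add] at this; omega
  exact (Nat.eq_of_mul_eq_mul_left (Nat.factorial_pos y) h1).symm

theorem mm_prime {w k : ℕ} (hk : k < w) (hw : 3 ≤ w) : ∃ p, p.Prime ∧ p ∣ mm w k ∧ w < p := by
  have h3 : 3 ∣ mm w k + 1 := (Nat.dvd_factorial (by omega) hw).trans (mm_dvd hk)
  have hne : mm w k ≠ 1 := by intro h; rw [h] at h3; omega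
  refine ⟨_, Nat.minFac_prime hne, Nat.minFac_dvd _, ?_⟩
  by_contra hlt
  have hp := Nat.minFac_prime hne
  have := Nat.eq_one_of_dvd_coprimes (mm_coprime hk hp.pos (not_lt.1 hlt)) (Nat.minFac_dvd _) dvd_rfl
  exact hp.one_lt.ne' this

theorem choose_mod {p a u : ℕ} (hp : p.Prime) (h : p ∣ a.choose u) : a % p < u := by
  have h1 : p ∣ a.descFactorial u := by
    rw [Nat.descFactorial_eq_factorial_mul_choose]; exact h.mul_left _
  by_cases hau : a < u
  · exact (Nat.mod_le _ _).trans_lt hau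
  rw [Nat.descFactorial_eq_prod_range, hp.prime.dvd_finset_prod_iff] at h1
  obtain ⟨j, hj, hd⟩ := h1
  simp at hj
  have : j ≡ a [MOD p] := (Nat.modEq_iff_dvd' (by omega)).2 hd
  rw [← this]
  exact (Nat.mod_le _ _).trans_lt hj

theorem dvd_choose' {m a u j : ℕ} (hc : Nat.Coprime m (u !)) (h : a ≡ j [MOD m]) (hj : j < u) :
    m ∣ a.choose u := by
  refine hc.dvd_of_dvd_mul_left ?_
  rw [← Nat.descFactorial_eq_factorial_mul_choose]
  by_cases hau : a < u
  · rw [Nat.descFactorial_of_lt hau]; exact dvd_zero _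
  rw [Nat.descFactorial_eq_prod_range]
  exact ((Nat.modEq_iff_dvd' (by omega)).1 h.symm).trans
    (Finset.dvd_prod_of_mem (fun i => a - i) (Finset.mem_range.2 hj))

def Eqn.satMod {σ : Type} (M : ℕ) (w : σ → ℕ) : Eqn σ → Prop
  | .one k => w k ≡ 1 [MOD M]
  | .add i j k => w i + w j ≡ w k [MOD M]
  | .mul i j k => w i * w j ≡ w k [MOD M]

theorem list_bound {σ : Type} (l : List σ) (f : σ → ℕ) : ∃ u, ∀ i ∈ l, f i < u := by
  induction l with
  | nil => exact ⟨0, by simp⟩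
  | cons a l ih =>
    obtain ⟨u, hu⟩ := ih
    refine ⟨max u (f a + 1), fun i hi => ?_⟩
    rcases List.mem_cons.1 hi with rfl | hi
    · omega
    · have := hu i hi; omega

theorem prod_modEq {y a b : ℕ} (m : ℕ → ℕ) (hc : ∀ i < y, ∀ j < y, i ≠ j → Nat.Coprime (m i) (m j))
    (h : ∀ i < y, a ≡ b [MOD m i]) : a ≡ b [MOD ∏ k ∈ Finset.range y, m k] := by
  rw [Nat.modEq_iff_dvd]
  push_cast
  refine Finset.prod_dvd_of_coprime (fun i hi j hj hij => ?_) fun i hi => ?_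
  · simp at hi hj
    exact Nat.isCoprime_iff_coprime.2 (hc i hi j hj hij)
  · simp at hi
    exact Nat.modEq_iff_dvd.1 (h i hi)

theorem bq {α τ : Type} (L : List (Eqn (Option α ⊕ τ))) (v : α → ℕ) (y : ℕ) :
    (∀ x < y, ∃ t, ∀ e ∈ L, e.sat (Sum.elim (Option.elim' x v) t)) ↔
    ∃ (a : τ → ℕ) (u : ℕ), y < u ∧ ∀ e ∈ L,
      e.satMod (((u * u + 2 * u + 3)! * (u * u + 2 * u + 3)! - 1).choose y)
        (Sum.elim (Option.elim' ((u * u + 2 * u + 3)! * (u * u + 2 * u + 3)! - 1) v) a) ∧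
      ∀ i ∈ e.vars, (((u * u + 2 * u + 3)! * (u * u + 2 * u + 3)! - 1).choose y) ∣
        Nat.choose (Sum.elim
          (Option.elim' ((u * u + 2 * u + 3)! * (u * u + 2 * u + 3)! - 1) v) a i) u ∧
        (Sum.elim (Option.elim' 0 v) (fun _ => 0) i : ℕ) < u := by
  constructor
  · intro h
    choose! t ht using h
    obtain ⟨u, hu⟩ := list_bound (L.flatMap Eqn.vars) (fun i =>
      y + (Sum.elim (Option.elim' 0 v) (fun _ => 0) i : ℕ) +
        ∑ x ∈ Finset.range y, (Sum.elim (Option.elim' x v) (t x) i : ℕ))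
    obtain ⟨u, hu, hyu⟩ : ∃ u, (∀ e ∈ L, ∀ i ∈ e.vars,
        (Sum.elim (Option.elim' 0 v) (fun _ => 0) i : ℕ) < u ∧
        ∀ x < y, (Sum.elim (Option.elim' x v) (t x) i : ℕ) < u) ∧ y < u := by
      refine ⟨u + y + 1, fun e he i hi => ?_, by omega⟩
      have h1 := hu i (List.mem_flatMap.2 ⟨e, he, hi⟩)
      refine ⟨by omega, fun x hx => ?_⟩
      have h2 := Finset.single_le_sum (f := fun x => (Sum.elim (Option.elim' x v) (t x) i : ℕ))
        (fun _ _ => Nat.zero_le _) (Finset.mem_range.2 hx)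

      omega
    set w := u * u + 2 * u + 3 with hw
    have huw : u ≤ w := by nlinarith
    have hyw : y ≤ w := by omega
    have hcop : ∀ i < y, ∀ j < y, i ≠ j → Nat.Coprime (mm w i) (mm w j) :=
      fun i hi j hj hij => mm_pair (by omega) (by omega) hij
    have crt : ∀ i : τ, ∃ a, ∀ x < y, a ≡ t x i [MOD mm w x] := by
      intro i
      obtain ⟨a, ha⟩ := Nat.chineseRemainderOfFinset (fun x => t x i) (mm w) (Finset.range y)
        (fun x hx h0 => by
          simp at hx
          have := mm_coprime_fact (w := w) (k := x) (by omega)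
          rw [h0, Nat.coprime_zero_left] at this
          have h3 := Nat.self_le_factorial w
          omega)
        (fun x hx z hz hxz => by simp at hx hz; exact hcop x hx z hz hxz)
      exact ⟨a, fun x hx => ha x (Finset.mem_range.2 hx)⟩
    choose a ha using crt
    refine ⟨a, u, hyu, fun e he => ?_⟩
    rw [← hw]
    set A := Sum.elim (Option.elim' (w ! * (w !) - 1) v) a with hA
    have key : ∀ x < y, ∀ i, A i ≡ Sum.elim (Option.elim' x v) (t x) i [MOD mm w x] := by
      intro x hx i
      rcases i with (_ | i) | i
      · change w ! * (w !) - 1 ≡ x [MOD mm w x]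
        have := mm_mul (w := w) (k := x) (by omega)
        have e : w ! * (w !) - 1 = x + mm w x * (x + 1) := by
          rw [← this]
          have : (x + 1) * (mm w x + 1) = x + mm w x * (x + 1) + 1 := by ring
          omega
        rw [e]
        simp [Nat.ModEq]
      · exact Nat.ModEq.refl _
      · exact ha i x hx
    rw [← mm_prod hyw]
    constructor
    · have hs := fun x (hx : x < y) => ht x hx e he
      cases e with
      | one k =>
        refine prod_modEq _ hcop fun x hx => ?_
        have := hs x hx
        simp only [Eqn.sat] at this
        rw [← this]; exact key x hx k
      | add i j k =>
        refine prod_modEq _ hcop fun x hx => ?_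
        have := hs x hx
        simp only [Eqn.sat] at this
        refine ((key x hx i).add (key x hx j)).trans ?_
        rw [this]; exact (key x hx k).symm
      | mul i j k =>
        refine prod_modEq _ hcop fun x hx => ?_
        have := hs x hx
        simp only [Eqn.sat] at this
        refine ((key x hx i).mul (key x hx j)).trans ?_
        rw [this]; exact (key x hx k).symm
    · intro i hi
      refine ⟨?_, (hu e he i hi).1⟩
      rw [← Nat.modEq_zero_iff_dvd]
      refine prod_modEq _ hcop fun x hx => ?_
      rw [Nat.modEq_zero_iff_dvd]
      exact dvd_choose' (Nat.Coprime.coprime_dvd_right (Nat.factorial_dvd_factorial huw)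
        (mm_coprime_fact (by omega))) (key x hx i) ((hu e he i hi).2 x hx)
  · rintro ⟨a, u, hyu, h⟩ x hx
    set w := u * u + 2 * u + 3 with hw
    have huw : u ≤ w := by nlinarith
    have hyw : y ≤ w := by omega
    obtain ⟨p, hp, hpd, hwp⟩ := mm_prime (w := w) (k := x) (by omega) (by omega)
    set A := Sum.elim (Option.elim' (w ! * (w !) - 1) v) a with hA
    rw [← mm_prod hyw] at h
    have hpM : p ∣ ∏ k ∈ Finset.range y, mm w k :=
      hpd.trans (Finset.dvd_prod_of_mem _ (Finset.mem_range.2 hx))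
    refine ⟨fun i => a i % p, fun e he => ?_⟩
    obtain ⟨h1, h2⟩ := h e he
    have hlt : ∀ i ∈ e.vars, A i % p < u := fun i hi => choose_mod hp (hpM.trans (h2 i hi).1)
    have hv : ∀ i ∈ e.vars, Sum.elim (Option.elim' x v) (fun i => a i % p) i = A i % p := by
      intro i hi
      rcases i with (_ | i) | i
      · change x = (w ! * (w !) - 1) % p
        have := mm_mul (w := w) (k := x) (by omega)
        obtain ⟨c, hc⟩ := hpd
        have e : w ! * (w !) - 1 = x + p * (c * (x + 1)) := by
          rw [← this, hc]
          have : (x + 1) * (p * c + 1) = x + p * (c * (x + 1)) + 1 := by ring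
          omega
        rw [e, Nat.add_mul_mod_self_left, Nat.mod_eq_of_lt (by omega)]
      · change v i = v i % p
        have := (h2 _ hi).2
        simp at this
        rw [Nat.mod_eq_of_lt (by omega)]
      · rfl
    rw [Eqn.sat_congr hv]
    cases e with
    | one k =>
      have h3 : A k % p = 1 % p := Nat.ModEq.of_dvd hpM h1
      simp only [Eqn.sat]
      rw [h3, Nat.mod_eq_of_lt (by omega)]
    | add i j k =>
      have h3 : A i + A j ≡ A k [MOD p] := Nat.ModEq.of_dvd hpM h1
      have hi := hlt i (by simp [Eqn.vars])
      have hj := hlt j (by simp [Eqn.vars])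
      have hk := hlt k (by simp [Eqn.vars])
      have h4 : A i % p + A j % p ≡ A k % p [MOD p] :=
        (((Nat.mod_modEq _ _).add (Nat.mod_modEq _ _)).trans h3).trans (Nat.mod_modEq _ _).symm
      have hb : A i % p + A j % p < p := by nlinarith
      exact Nat.ModEq.eq_of_lt_of_lt h4 hb (show A k % p < p by omega)
    | mul i j k =>
      have h3 : A i * A j ≡ A k [MOD p] := Nat.ModEq.of_dvd hpM h1
      have hi := hlt i (by simp [Eqn.vars])
      have hj := hlt j (by simp [Eqn.vars])
      have hk := hlt k (by simp [Eqn.vars])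
      have h4 : (A i % p) * (A j % p) ≡ A k % p [MOD p] :=
        (((Nat.mod_modEq _ _).mul (Nat.mod_modEq _ _)).trans h3).trans (Nat.mod_modEq _ _).symm
      have hb : (A i % p) * (A j % p) < p := by
        have := Nat.mul_le_mul hi.le hj.le
        omega
      exact Nat.ModEq.eq_of_lt_of_lt h4 hb (show A k % p < p by omega)

end DPRM

namespace DPRM
open Nat Dioph

section
variable {α β : Type}

theorem univ_dioph : Dioph (Set.univ : Set (α → ℕ)) :=
  Dioph.ext (eq_dioph (const_dioph 0) (const_dioph 0)) fun v => by simp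

theorem list_dioph {ι : Type} (P : ι → Set (α → ℕ)) (l : List ι) (h : ∀ i ∈ l, Dioph (P i)) :
    Dioph {v | ∀ i ∈ l, v ∈ P i} := by
  induction l with
  | nil => exact Dioph.ext univ_dioph fun v => by simp
  | cons a l ih =>
    refine Dioph.ext ((h a (by simp)).inter (ih fun i hi => h i (by simp [hi]))) fun v => ?_
    simp

theorem satMod_dioph {σ : Type} {A : σ → (α → ℕ) → ℕ} {M : (α → ℕ) → ℕ} (hM : DiophFn M)
    (hA : ∀ i, DiophFn (A i)) (e : Eqn σ) : Dioph {z | e.satMod (M z) (fun i => A i z)} := by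
  cases e with
  | one k => exact modEq_dioph (hA k) (const_dioph 1) hM
  | add i j k => exact modEq_dioph (add_dioph (hA i) (hA j)) (hA k) hM
  | mul i j k => exact modEq_dioph (mul_dioph (hA i) (hA j)) (hA k) hM

theorem all_dioph {S : Set (Option α → ℕ)} (hS : Dioph S) {g : (α → ℕ) → ℕ} (hg : DiophFn g) :
    Dioph {v | ∀ x < g v, Option.elim' x v ∈ S} := by
  obtain ⟨τ, L, hL⟩ := sysForm hS
  let G : (Option (α ⊕ τ) → ℕ) → ℕ := fun z => g (fun i => z (some (.inl i)))
  have dG : DiophFn G := reindex_diophFn (fun i => some (Sum.inl i)) hg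
  let U : (Option (α ⊕ τ) → ℕ) → ℕ := fun z => z none
  have dU : DiophFn U := proj_dioph none
  let W : (Option (α ⊕ τ) → ℕ) → ℕ := fun z =>
    (U z * U z + 2 * U z + 3)! * (U z * U z + 2 * U z + 3)! - 1
  have dW : DiophFn W := by
    have : DiophFn fun z => (U z * U z + 2 * U z + 3)! :=
      factorial_dioph (add_dioph (add_dioph (mul_dioph dU dU) (mul_dioph (const_dioph 2) dU))
        (const_dioph 3))
    exact sub_dioph (mul_dioph this this) (const_dioph 1)
  let M : (Option (α ⊕ τ) → ℕ) → ℕ := fun z => (W z).choose (G z)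
  have dM : DiophFn M := choose_dioph dW dG
  let A : (Option α ⊕ τ) → (Option (α ⊕ τ) → ℕ) → ℕ := fun i z =>
    Sum.elim (Option.elim' (W z) (fun i => z (some (.inl i)))) (fun i => z (some (.inr i))) i
  have dA : ∀ i, DiophFn (A i) := by
    rintro ((_ | i) | i)
    · exact dW
    · exact proj_dioph (some (Sum.inl i))
    · exact proj_dioph (some (Sum.inr i))
  let B : (Option α ⊕ τ) → (Option (α ⊕ τ) → ℕ) → ℕ := fun i z =>
    Sum.elim (Option.elim' 0 (fun i => z (some (.inl i)))) (fun i => 0) i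
  have dB : ∀ i, DiophFn (B i) := by
    rintro ((_ | i) | i)
    · exact const_dioph 0
    · exact proj_dioph (some (Sum.inl i))
    · exact const_dioph 0
  have main : Dioph ({z | G z < U z} ∩ {z | ∀ e ∈ L, z ∈ ({z | e.satMod (M z) (fun i => A i z)} ∩
      {z | ∀ i ∈ e.vars, z ∈ ({z | M z ∣ (A i z).choose (U z)} ∩ {z | B i z < U z})})}) := by
    refine (lt_dioph dG dU).inter (list_dioph _ L fun e _ => (satMod_dioph dM dA e).inter
      (list_dioph _ _ fun i _ => (dvd_dioph dM (choose_dioph (dA i) dU)).inter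
        (lt_dioph (dB i) dU)))
  refine Dioph.ext (ex_dioph (ex1_dioph main)) fun v => ?_
  have := bq L v (g v)
  simp only [← hL] at this
  exact this.symm

theorem subst_dioph [Fintype β] {S : Set (β → ℕ)} (hS : Dioph S) {f : β → (α → ℕ) → ℕ}
    (hf : ∀ i, DiophFn (f i)) : Dioph {v | (fun i => f i v) ∈ S} := by
  have h1 : Dioph ({z : α ⊕ β → ℕ | ∀ i ∈ (Finset.univ : Finset β).toList,
      z ∈ {z : α ⊕ β → ℕ | z (.inr i) = f i (z ∘ .inl)}} ∩ {z | z ∘ .inr ∈ S}) :=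
    (list_dioph _ _ fun i _ => eq_dioph (proj_dioph _) (reindex_diophFn _ (hf i))).inter
      (reindex_dioph _ _ hS)
  refine Dioph.ext (ex_dioph h1) fun v => ?_
  constructor
  · rintro ⟨x, hx, hxS⟩
    simp at hx
    have e1 : (Sum.elim v x ∘ Sum.inl) = v := rfl
    have e2 : (Sum.elim v x ∘ Sum.inr) = x := rfl
    have : x = fun i => f i v := funext fun i => hx i
    change x ∈ S at hxS
    rw [this] at hxS
    exact hxS
  · intro h
    exact ⟨fun i => f i v, fun i _ => rfl, h⟩

theorem subst_fn [Fintype β] {F : (β → ℕ) → ℕ} (hF : DiophFn F) {f : β → (α → ℕ) → ℕ}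
    (hf : ∀ i, DiophFn (f i)) : DiophFn fun v => F (fun i => f i v) := by
  have := subst_dioph (α := Option α) hF
    (f := fun i => Option.elim' (fun z => z none) (fun i z => f i (z ∘ some)) i) (by
      rintro (_ | i)
      · exact proj_dioph none
      · exact reindex_diophFn some (hf i))
  exact Dioph.ext this fun v => Iff.rfl

def bt (s b i : ℕ) : ℕ := s % ((i + 1) * b + 1)

theorem bt_dioph {s b i : (α → ℕ) → ℕ} (hs : DiophFn s) (hb : DiophFn b) (hi : DiophFn i) :
    DiophFn fun v => bt (s v) (b v) (i v) :=
  mod_dioph hs (add_dioph (mul_dioph (add_dioph hi (const_dioph 1)) hb) (const_dioph 1))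

theorem exists_bt (c : ℕ → ℕ) (n : ℕ) : ∃ s b, ∀ i ≤ n, bt s b i = c i := by
  let l := (List.range (n + 1)).map c
  refine ⟨(Nat.unbeta l).unpair.1, (Nat.unbeta l).unpair.2, fun i hi => ?_⟩
  have := Nat.beta_unbeta_coe l ⟨i, by simp [l]; omega⟩
  simp [l] at this
  rw [← this]
  rfl
end

def DT {n : ℕ} (f : List.Vector ℕ n → ℕ) : Prop :=
  DiophFn fun v : Fin n → ℕ => f (List.Vector.ofFn v)

theorem DT.subst {α : Type} {n : ℕ} {f : List.Vector ℕ n → ℕ} (h : DT f) {g : Fin n → (α → ℕ) → ℕ}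
    (hg : ∀ i, DiophFn (g i)) : DiophFn fun v => f (List.Vector.ofFn fun i => g i v) :=
  subst_fn h hg

theorem prec_iff (a : ℕ) (g : ℕ → ℕ → ℕ) (n r : ℕ) :
    (Nat.rec a g n : ℕ) = r ↔ ∃ s b, bt s b 0 = a ∧
      (∀ x < n, bt s b (x + 1) = g x (bt s b x)) ∧ bt s b n = r := by
  constructor
  · intro h
    obtain ⟨s, b, hsb⟩ := exists_bt (fun k => (Nat.rec a g k : ℕ)) n
    refine ⟨s, b, hsb 0 (by omega), fun x hx => ?_, (hsb n le_rfl).trans h⟩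
    rw [hsb (x + 1) (by omega), hsb x (by omega)]
  · rintro ⟨s, b, h0, h1, h2⟩
    have : ∀ k ≤ n, bt s b k = (Nat.rec a g k : ℕ) := by
      intro k
      induction k with
      | zero => intro _; exact h0
      | succ k ih => intro hk; rw [h1 k (by omega), ih (by omega)]
    rw [← this n le_rfl, h2]

theorem DT.prec {n : ℕ} {f : List.Vector ℕ n → ℕ} {g : List.Vector ℕ (n + 2) → ℕ}
    (hf : DT f) (hg : DT g) : DT (fun v : List.Vector ℕ (n + 1) =>
      (v.head.rec (f v.tail) fun y IH => g (y ::ᵥ IH ::ᵥ v.tail) : ℕ)) := by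
  -- variables: b = z none, s = z (some none), output z (some (some none)), inputs
  let V := Option (Option (Option (Fin (n + 1))))
  have dx : ∀ i : Fin (n + 1), DiophFn fun z : V → ℕ => z (some (some (some i))) :=
    fun i => proj_dioph _
  have db : DiophFn fun z : V → ℕ => z none := proj_dioph _
  have ds : DiophFn fun z : V → ℕ => z (some none) := proj_dioph _
  have dr : DiophFn fun z : V → ℕ => z (some (some none)) := proj_dioph _
  have d1 : Dioph {z : V → ℕ | bt (z (some none)) (z none) 0 =
      f (List.Vector.ofFn fun i : Fin n => z (some (some (some i.succ))))} :=
    eq_dioph (bt_dioph ds db (const_dioph 0)) (hf.subst fun i => dx i.succ)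
  have d3 : Dioph {z : V → ℕ | bt (z (some none)) (z none) (z (some (some (some 0)))) =
      z (some (some none))} :=
    eq_dioph (bt_dioph ds db (dx 0)) dr
  have d2 : Dioph {z : Option V → ℕ | bt (z (some (some none))) (z (some none)) (z none + 1) =
      g (List.Vector.ofFn fun i : Fin (n + 2) => (Fin.cons (z none)
        (Fin.cons (bt (z (some (some none))) (z (some none)) (z none))
          (fun i : Fin n => z (some (some (some (some i.succ)))))) : Fin (n + 2) → ℕ) i)} := by
    have ds' : DiophFn fun z : Option V → ℕ => z (some (some none)) := proj_dioph _
    have db' : DiophFn fun z : Option V → ℕ => z (some none) := proj_dioph _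
    have dx' : DiophFn fun z : Option V → ℕ => z none := proj_dioph _
    refine eq_dioph (bt_dioph ds' db' (add_dioph dx' (const_dioph 1))) (hg.subst fun i => ?_)
    refine Fin.cases ?_ (fun i => ?_) i
    · exact dx'
    · refine Fin.cases ?_ (fun i => ?_) i
      · exact bt_dioph ds' db' dx'
      · exact proj_dioph (some (some (some (some i.succ))))
  have d4 := d1.inter ((all_dioph d2 (dx 0)).inter d3)
  refine Dioph.ext (ex1_dioph (ex1_dioph d4)) fun w => ?_
  refine Iff.trans ?_ (prec_iff _ _ _ _).symm
  have ht : (List.Vector.ofFn (w ∘ some)).tail = List.Vector.ofFn fun i : Fin n => w (some i.succ) := by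
    simp [List.Vector.ofFn]
  have hh : (List.Vector.ofFn (w ∘ some)).head = w (some 0) := by
    simp [List.Vector.ofFn]
  rw [ht, hh]
  rfl

theorem dt_of_primrec {n : ℕ} {f : List.Vector ℕ n → ℕ} (h : Nat.Primrec' f) : DT f := by
  induction h with
  | zero => exact const_dioph 0
  | succ =>
    have : DiophFn fun v : Fin 1 → ℕ => v 0 + 1 := add_dioph (proj_dioph 0) (const_dioph 1)
    exact this
  | get i =>
    have := proj_dioph i
    simpa [DT] using this
  | comp g _ _ hf hg => exact hf.subst hg
  | prec _ _ hf hg => exact hf.prec hg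

def DP {n : ℕ} (f : List.Vector ℕ n →. ℕ) : Prop :=
  Dioph {w : Option (Fin n) → ℕ | w none ∈ f (List.Vector.ofFn (w ∘ some))}

theorem dp_iff_dt {n : ℕ} {f : List.Vector ℕ n → ℕ} : DP (f : List.Vector ℕ n →. ℕ) ↔ DT f := by
  unfold DP DT DiophFn
  simp [eq_comm]

theorem mem_mOfFn {m : ℕ} (g : Fin m → Part ℕ) (a : List.Vector ℕ m) :
    a ∈ List.Vector.mOfFn g ↔ ∀ i, a.get i ∈ g i := by
  induction m with
  | zero => simp [List.Vector.mOfFn, List.Vector.eq_nil a]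
  | succ m ih =>
    obtain ⟨x, a, rfl⟩ := a.exists_eq_cons
    simp only [List.Vector.mOfFn]
    simp only [Part.bind_eq_bind, Part.mem_bind_iff, ih, Part.pure_eq_some, Part.mem_some_iff,
      Fin.forall_fin_succ, List.Vector.get_zero, List.Vector.head_cons, List.Vector.get_cons_succ]
    constructor
    · rintro ⟨y, hy, b, hb, hab⟩
      have h1 := congrArg List.Vector.head hab
      have h2 := congrArg List.Vector.tail hab
      simp at h1 h2
      subst h1 h2
      exact ⟨hy, hb⟩
    · rintro ⟨hx, ha⟩
      exact ⟨x, hx, a, ha, rfl⟩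

theorem dp_of_partrec {n : ℕ} {f : List.Vector ℕ n →. ℕ} (h : Nat.Partrec' f) : DP f := by
  induction h with
  | prim hf => exact dp_iff_dt.2 (dt_of_primrec hf)
  | @comp m n f g _ _ hf hg =>
    have d1 : Dioph {z : Option (Fin m) ⊕ Fin n → ℕ | ∀ i ∈ (Finset.univ : Finset (Fin n)).toList,
        z ∈ {z : Option (Fin m) ⊕ Fin n → ℕ |
          z (.inr i) ∈ g i (List.Vector.ofFn fun j => z (.inl (some j)))}} :=
      list_dioph _ _ fun i _ => 
        Dioph.ext (reindex_dioph (Option (Fin m) ⊕ Fin n)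
          (Option.elim' (.inr i) (fun j => .inl (some j))) (hg i)) fun v => Iff.rfl
    have d2 : Dioph {z : Option (Fin m) ⊕ Fin n → ℕ |
          z (.inl none) ∈ f (List.Vector.ofFn fun j => z (.inr j))} :=
        Dioph.ext (reindex_dioph (Option (Fin m) ⊕ Fin n)
          (Option.elim' (.inl none) (fun j => .inr j)) hf) fun v => Iff.rfl
    refine Dioph.ext (ex_dioph (d1.inter d2)) fun w => ?_
    refine Iff.trans ?_ (Part.mem_bind_iff (b := w none)
      (f := List.Vector.mOfFn fun i => g i (List.Vector.ofFn (w ∘ some))) (g := f)).symm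
    simp only [mem_mOfFn]
    constructor
    · rintro ⟨x, h1, h2⟩
      exact ⟨List.Vector.ofFn x, fun i => by rw [List.Vector.get_ofFn]; exact h1 i (by simp), h2⟩
    · rintro ⟨a, h1, h2⟩
      exact ⟨a.get, fun i _ => h1 i, by
        change w none ∈ f (List.Vector.ofFn a.get)
        simpa using h2⟩
  | @rfind n f _ hf =>
    have hf := dp_iff_dt.1 hf
    have e : ∀ (x : ℕ) (u : Fin n → ℕ), x ::ᵥ List.Vector.ofFn u =
      List.Vector.ofFn fun i => (Fin.cons x u : Fin (n + 1) → ℕ) i := by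
      intro x u; simp [List.Vector.ofFn]
    have d1 : DiophFn fun w : Option (Fin n) → ℕ =>
        f (w none ::ᵥ List.Vector.ofFn fun i => w (some i)) := by
      simp only [e]
      refine hf.subst fun i => ?_
      refine Fin.cases ?_ (fun i => ?_) i
      · exact proj_dioph none
      · exact proj_dioph (some i)
    have d2 := reindex_diophFn (β := Option (Option (Fin n)))
      (Option.elim' none (fun i => some (some i))) d1
    have d3 := (eq_dioph d1 (const_dioph 0)).inter
      (all_dioph (ne_dioph d2 (const_dioph 0)) (proj_dioph none))
    refine Dioph.ext d3 fun w => ?_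
    refine Iff.trans ?_ Nat.mem_rfind.symm
    refine and_congr ?_ (forall_congr' fun x => forall_congr' fun hx => ?_)
    · simp [eq_comm]; rfl
    · simp [eq_comm]; rfl

theorem dioph_of_computable {f : ℕ → ℕ} (hf : Computable f) :
    DiophFn fun v : Fin 1 → ℕ => f (v 0) := by
  have h1 : Nat.Partrec' (fun v : List.Vector ℕ 1 => (f v.head : Part ℕ)) :=
    Nat.Partrec'.part_iff₁ (f := (f : ℕ →. ℕ)).2 hf
  have h2 := dp_iff_dt (f := fun v : List.Vector ℕ 1 => f v.head).1 (dp_of_partrec h1)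
  exact h2

end DPRM

namespace DPRM

def toD : Eqn ℕ → DEqn
  | .one k => Sum.inl k
  | .add i j k => Sum.inr (Sum.inl (i, j, k))
  | .mul i j k => Sum.inr (Sum.inr (i, j, k))

theorem holds_toD (w : ℕ → ℕ) (e : Eqn ℕ) : DEqn.holds w (toD e) ↔ e.sat w := by
  cases e <;> rfl

theorem inE_toD (n : ℕ) (e : Eqn ℕ) : DEqn.inE n (toD e) ↔ ∀ i ∈ e.vars, i < n := by
  cases e <;> simp [toD, DEqn.inE, Eqn.vars]

theorem vars_ren {σ τ : Type} (f : σ → τ) (e : Eqn σ) : (e.ren f).vars = e.vars.map f := by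
  cases e <;> rfl

theorem exists_index {σ : Type} (V : List σ) :
    ∃ φ : σ → ℕ, ∀ i ∈ V, ∃ hi : φ i < V.length, V[φ i] = i := by
  classical
  exact ⟨fun i => V.idxOf i, fun i hi =>
    ⟨List.idxOf_lt_length_of_mem hi, List.getElem_idxOf (List.idxOf_lt_length_of_mem hi)⟩⟩

theorem final (F : ℕ → ℕ)
    (hF : ∀ n, ∀ S : Set DEqn, (∀ e ∈ S, DEqn.inE n e) →
      (SolSet n S).Nonempty → ∃ x ∈ SolSet n S, ∀ i, x i ≤ F n)
    (h : ℕ → ℕ) (hc : Computable h) (hle : ∀ n, F n ≤ h n) : False := by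
  classical
  have hf : Computable fun m : ℕ => h (2 * m) + 1 :=
    Computable.succ.comp (hc.comp (Primrec.to_comp (Primrec.nat_mul.comp (Primrec.const 2) Primrec.id)))
  obtain ⟨τ, L, hL⟩ := sysForm (dioph_of_computable hf)
  let V : List (Option (Fin 1) ⊕ τ) := Sum.inl none :: Sum.inl (some 0) :: L.flatMap Eqn.vars
  let c := V.length
  obtain ⟨φ, hφ'⟩ := exists_index V
  have hVL : ∀ e ∈ L, ∀ i ∈ e.vars, i ∈ V := fun e he i hi =>
    List.mem_cons_of_mem _ (List.mem_cons_of_mem _ (List.mem_flatMap.2 ⟨e, he, hi⟩))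
  have hφ : ∀ i ∈ V, φ i < c := fun i hi => (hφ' i hi).1
  have hout : Sum.inl none ∈ V := by simp [V]
  have hin : Sum.inl (some 0) ∈ V := by simp [V]
  let m := c + 1
  let n := 2 * m
  let S0 : Set (Eqn ℕ) := {e | (∃ e' ∈ L, e = e'.ren φ) ∨ e = .add c c c ∨ e = .one (c + 1) ∨
    (∃ j < m, e = .add (c + j) (c + 1) (c + j + 1)) ∨ e = .add (c + m) c (φ (.inl (some 0)))}
  have hS0 : ∀ e ∈ S0, ∀ i ∈ e.vars, i < n := by
    have h1 := hφ _ hin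
    rintro e (⟨e', he', rfl⟩ | rfl | rfl | ⟨j, hj, rfl⟩ | rfl) i hi
    · rw [vars_ren, List.mem_map] at hi
      obtain ⟨a, ha, rfl⟩ := hi
      have := hφ a (hVL e' he' a ha)
      simp only [n, m]; omega
    all_goals
      simp only [Eqn.vars, List.mem_cons, List.not_mem_nil, or_false] at hi
      simp only [n, m] at *
      omega
  have ext : ∀ x : Fin n → ℕ, x ∈ SolSet n (toD '' S0) ↔ ∀ e ∈ S0, e.sat (extVal n x) := by
    intro x
    simp only [SolSet, Set.mem_setOf_eq, Set.forall_mem_image, holds_toD]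
  have sub : ∀ e ∈ toD '' S0, DEqn.inE n e := by
    rintro _ ⟨e, he, rfl⟩
    exact (inE_toD n e).2 (hS0 e he)
  have ne : (SolSet n (toD '' S0)).Nonempty := by
    let v : Option (Fin 1) → ℕ := Option.elim' (h (2 * m) + 1) (fun _ => m)
    obtain ⟨t, ht⟩ := (hL v).1 (show h (2 * m) + 1 = h (2 * m) + 1 from rfl)
    let w : ℕ → ℕ := fun i => if hi : i < c then Sum.elim v t (V[i]) else i - c
    have hw1 : ∀ i ∈ V, w (φ i) = Sum.elim v t i := by
      intro i hi
      have h2 := hφ i hi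
      simp only [w, dif_pos h2]
      congr 1
      exact (hφ' i hi).2
    have hw2 : ∀ j, w (c + j) = j := by
      intro j
      simp [w]
    have hw20 : w c = 0 := hw2 0
    refine ⟨fun i => w i, (ext _).2 fun e he => ?_⟩
    have : e.sat (extVal n fun i => w i) ↔ e.sat w := by
      apply Eqn.sat_congr
      intro i hi
      simp [extVal, hS0 e he i hi]
    rw [this]
    rcases he with ⟨e', he', rfl⟩ | rfl | rfl | ⟨j, hj, rfl⟩ | rfl
    · rw [Eqn.sat_ren]
      refine (Eqn.sat_congr fun i hi => ?_).1 (ht e' he')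
      exact (hw1 i (hVL e' he' i hi)).symm
    · simp [Eqn.sat, hw20]
    · simp [Eqn.sat, hw2]
    · simp only [Eqn.sat, hw2, add_assoc]
    · simp only [Eqn.sat, hw2, hw20, hw1 _ hin]
      rfl
  obtain ⟨x, hx, hb⟩ := hF n _ sub ne
  rw [ext] at hx
  set w := extVal n x with hw
  have h0 : w c = 0 := by
    have : w c + w c = w c := hx (.add c c c) (Or.inr (Or.inl rfl))
    omega
  have h1 : w (c + 1) = 1 := hx (.one (c + 1)) (Or.inr (Or.inr (Or.inl rfl)))
  have hj : ∀ j ≤ m, w (c + j) = j := by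
    intro j
    induction j with
    | zero => intro _; exact h0
    | succ j ih =>
      intro hj
      have h2 : w (c + j) + w (c + 1) = w (c + j + 1) :=
        hx (.add (c + j) (c + 1) (c + j + 1)) (Or.inr (Or.inr (Or.inr (Or.inl ⟨j, hj, rfl⟩))))
      rw [ih (by omega), h1] at h2
      exact h2.symm
  have h3 : w (c + m) + w c = w (φ (.inl (some 0))) := 
    hx (.add (c + m) c (φ (.inl (some 0)))) (Or.inr (Or.inr (Or.inr (Or.inr rfl))))
  rw [hj m le_rfl, h0, add_zero] at h3
  have h4 : (fun i : Option (Fin 1) => w (φ (.inl i))) ∈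
      {v : Option (Fin 1) → ℕ | h (2 * v (some 0)) + 1 = v none} := by
    refine (hL _).2 ⟨fun i => w (φ (.inr i)), fun e he => ?_⟩
    have := hx (e.ren φ) (Or.inl ⟨e, he, rfl⟩)
    rw [Eqn.sat_ren] at this
    refine (Eqn.sat_congr fun i _ => ?_).1 this
    rcases i with i | i <;> rfl
  have h5 : h (2 * w (φ (.inl (some 0)))) + 1 = w (φ (.inl none)) := h4
  rw [← h3] at h5
  have h6 : φ (.inl none) < n := by
    have := hφ _ hout
    simp only [n, m]; omega
  have h7 := hb ⟨_, h6⟩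
  have h8 : w (φ (.inl none)) = x ⟨_, h6⟩ := by simp [hw, extVal, h6]
  have h9 : F (2 * m) ≤ h (2 * m) := hle _
  have h10 : x ⟨_, h6⟩ ≤ F (2 * m) := h7
  omega

end DPRM

/-- if F n = f_ω₁(n) is well-defined for all n (least bound for all solvable
systems S ⊆ E_n, with no cardinality restriction), then F is not majorized by any computable
function. -/
theorem stmt_11 (F : ℕ → ℕ)
    (hF : ∀ n, IsLeast {b : ℕ | ∀ S : Set DEqn, (∀ e ∈ S, DEqn.inE n e) →
      (SolSet n S).Nonempty → ∃ x ∈ SolSet n S, ∀ i, x i ≤ b} (F n)) :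
    ¬ ∃ h : ℕ → ℕ, Computable h ∧ ∀ n, F n ≤ h n := by
  rintro ⟨h, hc, hle⟩
  exact DPRM.final F (fun n => (hF n).1) h hc hle
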